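/- arXiv:1601.03167 — 2 statements merged into one kernel-verified Lean document; each statement's English description precedes it below -/
import Mathlib

section
/- The function R₃ is strictly decreasing on the interval (−1, 0], and consequently R₃(t) > 0 = R₃(0) for every t ∈ (−1, 0); in particular log|Γ₃(1+t)| ≥ 0 on (−1,0). -/
open Complex Filter Topology Set

noncomputable section

/-- Euler–Mascheroni constant. -/
def γ : ℝ := Real.eulerMascheroniConstant

/-- The constant `D`. -/
def Dc : ℝ := -(1/6) * (γ + Real.pi^2/6 + 3/2)

/-- The constant `E`. -/
def Ec : ℝ := (1/4) * (γ + Real.log (2*Real.pi) + 1/2)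

/-- The constant `F`, with ζ'(-1) the (real) derivative value of the Riemann zeta function. -/
def Fc : ℝ := 3/8 - Real.log (2*Real.pi)/4 - (1/12 - (deriv riemannZeta (-1)).re)

/-- The series `log P₃(z)`. -/
def logP3 (z : ℂ) : ℂ :=
  ∑' n : ℕ, (let k : ℂ := (n : ℂ) + 1;
    -(k*(k+1)/2) * Complex.log (1 + z/k) + ((k+1)/2) * z
      - (1/4)*(1 + 1/k) * z^2 + (1/(6*k))*(1 + 1/k) * z^3)

/-- The holomorphic branch `L₃(z)` of `log Γ₃(1+z)`. -/
def L3 (z : ℂ) : ℂ := (Dc : ℂ) * z^3 + (Ec : ℂ) * z^2 + (Fc : ℂ) * z + logP3 z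

/-- The real version `R₃(t) = log |Γ₃(1+t)|`. -/
def R3 (t : ℝ) : ℝ :=
  Dc * t^3 + Ec * t^2 + Fc * t +
  ∑' n : ℕ, (let k : ℝ := (n : ℝ) + 1;
    -(k*(k+1)/2) * Real.log |1 + t/k| + ((k+1)/2) * t
      - (1/4)*(1 + 1/k) * t^2 + (1/(6*k))*(1 + 1/k) * t^3)

/-- The function `f₃`. -/
def f3 (z : ℂ) : ℂ := L3 z / (z^3 * Complex.log z)

/-- The zero counting function `N₃`. -/
def N3 (s : ℝ) : ℝ := (⌊s⌋ : ℝ) * ((⌊s⌋ : ℝ) + 1) * ((⌊s⌋ : ℝ) + 2) / 6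

open Classical in
/-- The density `d̃₃`. -/
def d3tilde (t : ℝ) : ℝ :=
  if t < 0 ∧ ¬ (∃ n : ℕ, t = -((n : ℝ) + 1)) then
    -(R3 t + N3 |t| * Real.log |t|) / (t^3 * ((Real.log |t|)^2 + Real.pi^2))
  else 0

end

/-- The Taylor remainder `x - x²/2 + x³/3 - log (1 + x)`. -/
noncomputable def logRemainder (x : ℝ) : ℝ := x - x ^ 2 / 2 + x ^ 3 / 3 - Real.log (1 + x)

lemma hasDerivAt_logRemainder {x : ℝ} (hx : -1 < x) :
    HasDerivAt logRemainder (x ^ 3 / (1 + x)) x := by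
  have h1 : (1 + x) ≠ 0 := by linarith
  have h := ((((hasDerivAt_id x).sub (((hasDerivAt_id x).pow 2).div_const 2)).add
    (((hasDerivAt_id x).pow 3).div_const 3)).sub (((hasDerivAt_id x).const_add 1).log h1))
  refine h.congr_deriv ?_
  simp only [id]
  field_simp
  ring

lemma antitoneOn_logRemainder : AntitoneOn logRemainder (Ioc (-1 : ℝ) 0) := by
  refine antitoneOn_of_deriv_nonpos (convex_Ioc _ _)
    (fun x hx => (hasDerivAt_logRemainder hx.1).continuousAt.continuousWithinAt)
    (fun x hx => ?_) (fun x hx => ?_)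
  · rw [interior_Ioc] at hx
    exact (hasDerivAt_logRemainder hx.1).differentiableAt.differentiableWithinAt
  · rw [interior_Ioc] at hx
    rw [(hasDerivAt_logRemainder hx.1).deriv]
    have h3 : x ^ 3 ≤ 0 := (Odd.pow_neg (by decide) hx.2).le
    exact div_nonpos_of_nonpos_of_nonneg h3 (by linarith [hx.1])

lemma abs_logRemainder_le {x : ℝ} (hx : |x| < 1) :
    |logRemainder x| ≤ |x| ^ 4 / (1 - |x|) := by
  have h := Real.abs_log_sub_add_sum_range_le (x := -x) (by rwa [abs_neg]) 3
  rw [abs_neg] at h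
  refine le_trans (le_of_eq ?_) h
  rw [← abs_neg]
  congr 1
  simp only [logRemainder, Finset.sum_range_succ, Finset.sum_range_zero]
  push_cast
  rw [sub_neg_eq_add]
  ring

/-- The general term of the series in `R3`, in terms of `logRemainder`. -/
lemma R3_term_eq {t k : ℝ} (hk : 1 ≤ k) :
    -(k*(k+1)/2) * Real.log |1 + t/k| + ((k+1)/2) * t
      - (1/4)*(1 + 1/k) * t^2 + (1/(6*k))*(1 + 1/k) * t^3
      = k * (k + 1) / 2 * logRemainder (t / k) := by
  have hk0 : k ≠ 0 := by linarith
  rw [Real.log_abs, logRemainder]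
  field_simp
  ring

lemma summable_R3_term {t : ℝ} (ht : t ∈ Ioc (-1 : ℝ) 0) :
    Summable fun n : ℕ =>
      ((n : ℝ) + 1) * ((n : ℝ) + 1 + 1) / 2 * logRemainder (t / ((n : ℝ) + 1)) := by
  have hs : Summable fun n : ℕ => 1 / (1 - |t|) * (1 / ((n : ℝ) + 1) ^ 2) := by
    refine Summable.mul_left _ ?_
    have := (summable_nat_add_iff 1).2 (Real.summable_one_div_nat_pow.2 one_lt_two)
    simpa using this
  have hta : |t| < 1 := by rw [abs_lt]; constructor <;> linarith [ht.1, ht.2]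
  refine Summable.of_norm_bounded hs fun n => ?_
  set k : ℝ := (n : ℝ) + 1 with hk
  have hk1 : 1 ≤ k := by simp [hk]
  have hk0 : 0 < k := by linarith
  have hx : |t / k| = |t| / k := by rw [abs_div, abs_of_pos hk0]
  have hle : |t| / k ≤ |t| := div_le_self (abs_nonneg _) hk1
  have h1 := abs_logRemainder_le (x := t / k) (by rw [hx]; linarith)
  rw [hx] at h1
  have h2 : (|t| / k) ^ 4 / (1 - |t| / k) ≤ (1 / k) ^ 4 / (1 - |t|) := by
    have : 0 < 1 - |t| := by linarith
    gcongr
  rw [Real.norm_eq_abs, abs_mul, abs_of_nonneg (by positivity : 0 ≤ k * (k + 1) / 2)]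
  calc k * (k + 1) / 2 * |logRemainder (t / k)|
      ≤ k * k * ((1 / k) ^ 4 / (1 - |t|)) := by
        gcongr
        · nlinarith
        · exact h1.trans h2
    _ = 1 / (1 - |t|) * (1 / k ^ 2) := by
        have : 1 - |t| ≠ 0 := by linarith
        field_simp

lemma R3_eq_tsum (t : ℝ) :
    R3 t = Dc * t ^ 3 + Ec * t ^ 2 + Fc * t + ∑' n : ℕ,
      ((n : ℝ) + 1) * ((n : ℝ) + 1 + 1) / 2 * logRemainder (t / ((n : ℝ) + 1)) := by
  rw [R3]
  congr 1
  exact tsum_congr fun n => R3_term_eq (by simp)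

lemma vonMangoldt_LSeries_two_re_nonneg :
    0 ≤ (LSeries (fun n => (ArithmeticFunction.vonMangoldt n : ℂ)) 2).re := by
  have hs := ArithmeticFunction.LSeriesSummable_vonMangoldt (s := 2) (by norm_num)
  rw [LSeries, Complex.re_tsum hs]
  refine tsum_nonneg fun n => ?_
  rcases eq_or_ne n 0 with rfl | hn
  · simp
  · rw [LSeries.term_of_ne_zero hn]
    have : ((ArithmeticFunction.vonMangoldt n : ℂ) / (n : ℂ) ^ (2 : ℂ)) =
        ((ArithmeticFunction.vonMangoldt n / (n : ℝ) ^ 2 : ℝ) : ℂ) := by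
      push_cast
      norm_cast
    rw [this, Complex.ofReal_re]
    exact div_nonneg ArithmeticFunction.vonMangoldt_nonneg (by positivity)

/-- `ζ'(-1) = (1 - γ - log (2π) + ζ'(2)/ζ(2)) / 12`. -/
lemma deriv_riemannZeta_neg_one :
    deriv riemannZeta (-1) = (1 / 12) * (1 - (Real.eulerMascheroniConstant : ℂ)
      - (Real.log (2 * Real.pi) : ℂ) + deriv riemannZeta 2 / riemannZeta 2) := by
  have hpi : (Real.pi : ℂ) ≠ 0 := by exact_mod_cast Real.pi_ne_zero
  have hz : HasDerivAt riemannZeta (deriv riemannZeta 2) 2 :=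
    (differentiableAt_riemannZeta (by norm_num)).hasDerivAt
  have hG : HasDerivAt Complex.Gamma (1 - Real.eulerMascheroniConstant : ℂ) 2 := by
    have := Complex.hasDerivAt_Gamma_nat 1
    norm_num at this
    refine this.congr_deriv ?_
    ring
  have hc : HasDerivAt (fun s : ℂ => Complex.cos (Real.pi * s / 2)) 0 2 := by
    have h := (((hasDerivAt_id (2 : ℂ)).const_mul (Real.pi : ℂ)).div_const 2).ccos
    refine h.congr_deriv ?_
    simp
  have hp : HasDerivAt (fun s : ℂ => (2 * Real.pi : ℂ) ^ (-s))
      (-(Real.log (2 * Real.pi) : ℂ) / (2 * Real.pi) ^ 2) 2 := by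
    have h := (hasDerivAt_id (2 : ℂ)).neg.const_cpow (c := (2 * Real.pi : ℂ))
      (Or.inl (by simp))
    refine h.congr_deriv ?_
    have h2 : (2 * Real.pi : ℂ) ^ (-(2 : ℂ)) = ((2 * Real.pi : ℂ) ^ 2)⁻¹ := by
      rw [Complex.cpow_neg]; norm_cast
    have h3 : Complex.log (2 * Real.pi) = (Real.log (2 * Real.pi) : ℂ) := by
      rw [Complex.ofReal_log (by positivity)]; push_cast; rfl
    simp only [Pi.neg_apply, id, h2, h3]
    ring
  have hf := (((hp.const_mul 2).mul hG).mul hc).mul hz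
  have hl : HasDerivAt (fun s : ℂ => riemannZeta (1 - s)) (-deriv riemannZeta (-1)) 2 := by
    have h1 : HasDerivAt riemannZeta (deriv riemannZeta (-1)) (1 - 2) := by
      have : (1 - 2 : ℂ) = -1 := by norm_num
      rw [this]
      exact (differentiableAt_riemannZeta (by norm_num)).hasDerivAt
    have h := h1.comp (2 : ℂ) ((hasDerivAt_id (2 : ℂ)).const_sub 1)
    refine h.congr_deriv ?_
    simp
  have heq : (fun s : ℂ => riemannZeta (1 - s)) =ᶠ[𝓝 2]
      (fun s : ℂ => 2 * (2 * Real.pi : ℂ) ^ (-s) * Complex.Gamma s *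
        Complex.cos (Real.pi * s / 2) * riemannZeta s) := by
    have hopen : {s : ℂ | 1 < s.re} ∈ 𝓝 (2 : ℂ) :=
      (isOpen_lt continuous_const Complex.continuous_re).mem_nhds (by simp)
    filter_upwards [hopen] with s hs
    refine riemannZeta_one_sub (fun n h => ?_) (fun h => ?_)
    · rw [h] at hs
      simp at hs
      linarith [(Nat.cast_nonneg n : (0 : ℝ) ≤ n)]
    · rw [h] at hs
      simp at hs
  have key := hl.unique (hf.congr_of_eventuallyEq heq)
  have hG2 : Complex.Gamma 2 = 1 := by simp
  have hc2 : Complex.cos (Real.pi * 2 / 2) = -1 := by simp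
  have hp2 : (2 * Real.pi : ℂ) ^ (-(2 : ℂ)) = ((2 * Real.pi : ℂ) ^ 2)⁻¹ := by
    rw [Complex.cpow_neg]; norm_cast
  simp only [hG2, hc2, hp2, riemannZeta_two, Pi.mul_apply] at key
  rw [riemannZeta_two]
  rw [← neg_neg (deriv riemannZeta (-1)), key]
  field_simp
  ring

lemma Fc_neg : Fc < 0 := by
  have hz : (deriv riemannZeta 2 / riemannZeta 2).re ≤ 0 := by
    have h := ArithmeticFunction.LSeries_vonMangoldt_eq_deriv_riemannZeta_div
      (s := 2) (by norm_num)
    have h0 := vonMangoldt_LSeries_two_re_nonneg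
    rw [h, neg_div, Complex.neg_re] at h0
    linarith
  have hγ := Real.one_half_lt_eulerMascheroniConstant
  have hL : 2 * Real.log 2 ≤ Real.log (2 * Real.pi) := by
    rw [← Real.log_rpow two_pos]
    refine Real.log_le_log (by positivity) ?_
    norm_num
    linarith [Real.pi_gt_three]
  have hlog := Real.log_two_gt_d9
  have hre : (deriv riemannZeta (-1)).re = (1 / 12) * (1 - Real.eulerMascheroniConstant
      - Real.log (2 * Real.pi) + (deriv riemannZeta 2 / riemannZeta 2).re) := by
    rw [deriv_riemannZeta_neg_one, show (1 / 12 : ℂ) = ((1 / 12 : ℝ) : ℂ) by norm_num,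
      Complex.re_ofReal_mul]
    simp only [Complex.add_re, Complex.sub_re, Complex.one_re, Complex.ofReal_re]
  rw [Fc, hre]
  linarith

lemma Dc_neg : Dc < 0 := by
  have := Real.one_half_lt_eulerMascheroniConstant
  have := sq_nonneg Real.pi
  rw [Dc, γ]
  linarith

lemma Ec_pos : 0 < Ec := by
  have := Real.one_half_lt_eulerMascheroniConstant
  have := Real.log_nonneg (x := 2 * Real.pi) (by linarith [Real.pi_gt_three])
  rw [Ec, γ]
  linarith

lemma R3_zero : R3 0 = 0 := by
  simp [R3]

lemma strictAntiOn_R3 : StrictAntiOn R3 (Ioc (-1 : ℝ) 0) := by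
  intro s hs t ht hst
  rw [R3_eq_tsum s, R3_eq_tsum t]
  have h1 : Dc * t ^ 3 ≤ Dc * s ^ 3 :=
    mul_le_mul_of_nonpos_left ((Odd.strictMono_pow (by decide)).monotone hst.le) Dc_neg.le
  have h2 : Ec * t ^ 2 ≤ Ec * s ^ 2 :=
    mul_le_mul_of_nonneg_left (by nlinarith [hs.2, ht.2]) Ec_pos.le
  have h3 : Fc * t < Fc * s := mul_lt_mul_of_neg_left hst Fc_neg
  have hmem {u : ℝ} (hu : u ∈ Ioc (-1 : ℝ) 0) (n : ℕ) : u / ((n : ℝ) + 1) ∈ Ioc (-1 : ℝ) 0 := by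
    have hn : (0 : ℝ) ≤ n := n.cast_nonneg
    refine ⟨?_, div_nonpos_of_nonpos_of_nonneg hu.2 (by positivity)⟩
    rw [lt_div_iff₀ (by positivity)]
    linarith [hu.1]
  have h4 := (summable_R3_term ht).tsum_le_tsum (fun n => mul_le_mul_of_nonneg_left
    (antitoneOn_logRemainder (hmem hs n) (hmem ht n) (by gcongr))
    (by positivity : 0 ≤ ((n : ℝ) + 1) * ((n : ℝ) + 1 + 1) / 2)) (summable_R3_term hs)
  linarith

/-- `R₃` is strictly decreasing on `(−1,0]`; hence `R₃(t) > 0 = R₃(0)` on `(−1,0)`. -/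
theorem R3_strictAntiOn_and_pos :
    StrictAntiOn R3 (Set.Ioc (-1 : ℝ) 0) ∧ R3 0 = 0 ∧
      ∀ t ∈ Set.Ioo (-1 : ℝ) 0, 0 < R3 t := by
  refine ⟨strictAntiOn_R3, R3_zero, fun t ht => ?_⟩
  rw [← R3_zero]
  exact strictAntiOn_R3 ⟨ht.1, ht.2.le⟩ ⟨by norm_num, le_rfl⟩ ht.2
end

section
/- For every integer k ≥ 1 and every t ∈ (−k, −k+1), as z → t with Im z > 0 one has L₃(z) → R₃(t) − iπ·(k−1)k(k+1)/6. Equivalently, the branch log G₃(z) = L₃(z−1) of the logarithm of the triple Gamma function satisfies lim_{z→s, Im z>0} log G₃(z) = log|G₃(s)| − iπ·k(k+1)(k+2)/6 for s ∈ (−k, −k+1). -/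
open Complex Filter Topology Set

/-- The `n`-th term of the series `logP3`, with index `k = n + 1`. -/
noncomputable def logP3Term (z : ℂ) (n : ℕ) : ℂ :=
  -(((n : ℂ) + 1) * ((n : ℂ) + 1 + 1) / 2) * Complex.log (1 + z / ((n : ℂ) + 1))
    + (((n : ℂ) + 1 + 1) / 2) * z - (1 / 4) * (1 + 1 / ((n : ℂ) + 1)) * z ^ 2
    + (1 / (6 * ((n : ℂ) + 1))) * (1 + 1 / ((n : ℂ) + 1)) * z ^ 3

/-- The `n`-th term of the series in `R3`, with index `k = n + 1`. -/
noncomputable def logAbsP3Term (t : ℝ) (n : ℕ) : ℝ :=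
  -(((n : ℝ) + 1) * ((n : ℝ) + 1 + 1) / 2) * Real.log |1 + t / ((n : ℝ) + 1)|
    + (((n : ℝ) + 1 + 1) / 2) * t - (1 / 4) * (1 + 1 / ((n : ℝ) + 1)) * t ^ 2
    + (1 / (6 * ((n : ℝ) + 1))) * (1 + 1 / ((n : ℝ) + 1)) * t ^ 3

/-- The terms of `logP3` are the third order Taylor remainders of the logarithm. -/
lemma logP3Term_eq_logTaylor (z : ℂ) (n : ℕ) :
    logP3Term z n = -(((n : ℂ) + 1) * ((n : ℂ) + 1 + 1) / 2) *
      (Complex.log (1 + z / ((n : ℂ) + 1)) - Complex.logTaylor 4 (z / ((n : ℂ) + 1))) := by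
  have hn : (n : ℂ) + 1 ≠ 0 := Nat.cast_add_one_ne_zero n
  simp only [logP3Term, Complex.logTaylor, Finset.sum_range_succ, Finset.sum_range_zero]
  generalize Complex.log (1 + z / ((n : ℂ) + 1)) = w
  push_cast
  field_simp
  ring

lemma norm_logP3Term_le {z : ℂ} {n : ℕ} (hz : 2 * ‖z‖ ≤ (n : ℝ) + 1) :
    ‖logP3Term z n‖ ≤ ‖z‖ ^ 4 * (1 / ((n : ℝ) + 1) ^ 2) := by
  have hpos : (0 : ℝ) < (n : ℝ) + 1 := by positivity
  have hnorm : ‖(n : ℂ) + 1‖ = (n : ℝ) + 1 := by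
    exact_mod_cast Complex.norm_natCast (n + 1)
  have hnorm' : ‖(n : ℂ) + 1 + 1‖ = (n : ℝ) + 1 + 1 := by
    exact_mod_cast Complex.norm_natCast (n + 1 + 1)
  have hw : ‖z / ((n : ℂ) + 1)‖ = ‖z‖ / ((n : ℝ) + 1) := by rw [norm_div, hnorm]
  have hhalf : ‖z‖ / ((n : ℝ) + 1) ≤ 1 / 2 := by
    rw [div_le_iff₀ hpos]; linarith
  have hlog := Complex.norm_log_sub_logTaylor_le 3
    (z := z / ((n : ℂ) + 1)) (by rw [hw]; linarith)
  rw [hw] at hlog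
  have hinv : (1 - ‖z‖ / ((n : ℝ) + 1))⁻¹ ≤ 2 := by
    rw [inv_le_comm₀ (by linarith) two_pos]; linarith
  rw [logP3Term_eq_logTaylor, norm_mul, norm_neg, norm_div, norm_mul, hnorm, hnorm',
    Complex.norm_ofNat]
  calc ((n : ℝ) + 1) * ((n : ℝ) + 1 + 1) / 2 * _
      ≤ ((n : ℝ) + 1) ^ 2 * ((‖z‖ / ((n : ℝ) + 1)) ^ 4 * 2 / 4) := by
        gcongr
        · nlinarith [(Nat.cast_nonneg n : (0 : ℝ) ≤ n)]
        · refine hlog.trans ?_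
          norm_num
          gcongr
    _ = ‖z‖ ^ 4 * (1 / ((n : ℝ) + 1) ^ 2) / 2 := by field_simp; norm_num
    _ ≤ _ := half_le_self (by positivity)

/-- Dominated convergence for series, where domination is only required for large indices. -/
lemma tendsto_tsum_of_eventually_dominated {α : Type*} {l : Filter α} [l.NeBot]
    {f : α → ℕ → ℂ} {g : ℕ → ℂ} {b : ℕ → ℝ} (hb : Summable b) (N : ℕ)
    (hfg : ∀ n, Tendsto (f · n) l (𝓝 (g n)))
    (hle : ∀ᶠ x in l, ∀ n, N ≤ n → ‖f x n‖ ≤ b n) :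
    Summable g ∧ Tendsto (fun x => ∑' n, f x n) l (𝓝 (∑' n, g n)) := by
  set B : ℕ → ℝ := fun n => if n < N then ‖g n‖ + 1 else b n with hB
  have hBsum : Summable B := by
    rw [← summable_nat_add_iff N] at hb ⊢
    simpa [hB] using hb
  have hfB : ∀ᶠ x in l, ∀ n, ‖f x n‖ ≤ B n := by
    have hsmall : ∀ᶠ x in l, ∀ n ∈ Finset.range N, ‖f x n‖ ≤ ‖g n‖ + 1 := by
      rw [Filter.eventually_all_finset]
      intro n _
      exact (hfg n).norm.eventually_le_const (lt_add_one _)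
    filter_upwards [hle, hsmall] with x hx hx' n
    by_cases hn : n < N
    · simpa [hB, hn] using hx' n (Finset.mem_range.2 hn)
    · simpa [hB, hn] using hx n (not_lt.1 hn)
  refine ⟨Summable.of_norm_bounded hBsum fun n => ?_,
    tendsto_tsum_of_dominated_convergence hBsum hfg hfB⟩
  exact le_of_tendsto (hfg n).norm (hfB.mono fun x hx => hx n)

/-- Boundary values of the logarithm along the real axis, taken from the upper half plane. -/
lemma tendsto_log_one_add_div_upperHalfPlane {t a : ℝ} (ha : 0 < a) (hat : a + t ≠ 0) :
    Tendsto (fun z : ℂ => Complex.log (1 + z / a)) (𝓝[{z : ℂ | 0 < z.im}] (t : ℂ))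
      (𝓝 ((Real.log |1 + t / a| : ℝ) + if a + t < 0 then Real.pi * Complex.I else 0)) := by
  have hcont : Tendsto (fun z : ℂ => 1 + z / a) (𝓝[{z : ℂ | 0 < z.im}] (t : ℂ))
      (𝓝 ((1 + t / a : ℝ) : ℂ)) := by
    have : Continuous fun z : ℂ => 1 + z / a := by fun_prop
    simpa using (this.tendsto (t : ℂ)).mono_left nhdsWithin_le_nhds
  have heq : 1 + t / a = (a + t) / a := by field_simp
  split_ifs with h
  · have hneg : 1 + t / a < 0 := heq ▸ div_neg_of_neg_of_pos h ha
    have hlog := Complex.tendsto_log_nhdsWithin_im_nonneg_of_re_neg_of_im_zero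
      (z := ((1 + t / a : ℝ) : ℂ)) (by simpa using hneg) (Complex.ofReal_im _)
    rw [Complex.norm_real, Real.norm_eq_abs] at hlog
    refine hlog.comp (tendsto_nhdsWithin_iff.2 ⟨hcont, ?_⟩)
    filter_upwards [self_mem_nhdsWithin] with z hz
    simpa using div_nonneg (le_of_lt hz) ha.le
  · have hpos : 0 < 1 + t / a :=
      heq ▸ div_pos (lt_of_le_of_ne (not_lt.1 h) hat.symm) ha
    rw [add_zero, abs_of_pos hpos, Complex.ofReal_log hpos.le]
    exact hcont.clog (Complex.ofReal_mem_slitPlane.2 hpos)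

lemma tendsto_logP3Term {t : ℝ} {n : ℕ} (ht : (n : ℝ) + 1 + t ≠ 0) :
    Tendsto (logP3Term · n) (𝓝[{z : ℂ | 0 < z.im}] (t : ℂ))
      (𝓝 ((logAbsP3Term t n : ℂ) - if (n : ℝ) + 1 + t < 0 then
        ((n : ℂ) + 1) * ((n : ℂ) + 1 + 1) / 2 * (Real.pi * Complex.I) else 0)) := by
  have hlog := tendsto_log_one_add_div_upperHalfPlane (a := (n : ℝ) + 1) (by positivity) ht
  push_cast at hlog
  have hid : Tendsto (fun z : ℂ => z) (𝓝[{z : ℂ | 0 < z.im}] (t : ℂ)) (𝓝 (t : ℂ)) :=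
    tendsto_id.mono_left nhdsWithin_le_nhds
  have := (((hlog.const_mul (-(((n : ℂ) + 1) * ((n : ℂ) + 1 + 1) / 2))).add
    (hid.const_mul (((n : ℂ) + 1 + 1) / 2))).sub
    ((hid.pow 2).const_mul ((1 / 4) * (1 + 1 / ((n : ℂ) + 1))))).add
    ((hid.pow 3).const_mul ((1 / (6 * ((n : ℂ) + 1))) * (1 + 1 / ((n : ℂ) + 1))))
  convert this using 1
  · rfl
  · rw [logAbsP3Term]
    congr 1
    push_cast
    split_ifs <;> ring

lemma sum_range_triangular (m : ℕ) :
    ∑ n ∈ Finset.range m, ((n : ℂ) + 1) * ((n : ℂ) + 1 + 1) / 2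
      = (m : ℂ) * ((m : ℂ) + 1) * ((m : ℂ) + 1 + 1) / 6 := by
  induction m with
  | zero => simp
  | succ m ih => rw [Finset.sum_range_succ, ih]; push_cast; ring

/-- Boundary values of `logP3` on `(−(m+1), −m)`, taken from the upper half plane. -/
lemma tendsto_logP3 {m : ℕ} {t : ℝ} (ht : t ∈ Set.Ioo (-((m : ℝ) + 1)) (-(m : ℝ))) :
    Tendsto logP3 (𝓝[{z : ℂ | 0 < z.im}] (t : ℂ))
      (𝓝 (((∑' n, logAbsP3Term t n : ℝ) : ℂ)
        - (m : ℂ) * ((m : ℂ) + 1) * ((m : ℂ) + 1 + 1) / 6 * (Real.pi * Complex.I))) := by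
  obtain ⟨ht₁, ht₂⟩ := ht
  have hlt : ∀ n : ℕ, (n : ℝ) + 1 + t < 0 ↔ n < m := by
    refine fun n => ⟨fun h => ?_, fun h => ?_⟩
    · have : (n : ℝ) < m := by linarith
      exact_mod_cast this
    · have : (n : ℝ) + 1 ≤ m := by exact_mod_cast h
      linarith
  have hne : ∀ n : ℕ, (n : ℝ) + 1 + t ≠ 0 := by
    intro n h
    have h₁ : (m : ℝ) < (n + 1 : ℕ) := by push_cast; linarith
    have h₂ : ((n + 1 : ℕ) : ℝ) < (m + 1 : ℕ) := by push_cast; linarith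
    rw [Nat.cast_lt] at h₁ h₂
    omega
  have : (𝓝[{z : ℂ | 0 < z.im}] (t : ℂ)).NeBot := by
    rw [← mem_closure_iff_nhdsWithin_neBot, Complex.closure_setOfPred_lt_im]
    simp
  obtain ⟨N, hN⟩ := exists_nat_ge (2 * (‖(t : ℂ)‖ + 1))
  have hb : Summable fun n : ℕ => (‖(t : ℂ)‖ + 1) ^ 4 * (1 / ((n : ℝ) + 1) ^ 2) := by
    have := (summable_nat_add_iff 1).2 (Real.summable_one_div_nat_pow.2 one_lt_two)
    exact Summable.mul_left _ (by simpa using this)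
  have hle : ∀ᶠ z in 𝓝[{z : ℂ | 0 < z.im}] (t : ℂ), ∀ n, N ≤ n →
      ‖logP3Term z n‖ ≤ (‖(t : ℂ)‖ + 1) ^ 4 * (1 / ((n : ℝ) + 1) ^ 2) := by
    have hnorm : ∀ᶠ z in 𝓝[{z : ℂ | 0 < z.im}] (t : ℂ), ‖z‖ ≤ ‖(t : ℂ)‖ + 1 :=
      (tendsto_id.mono_left nhdsWithin_le_nhds).norm.eventually_le_const (lt_add_one _)
    filter_upwards [hnorm] with z hz n hn
    have hn' : (N : ℝ) ≤ n := by exact_mod_cast hn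
    exact (norm_logP3Term_le (by linarith)).trans (by gcongr)
  obtain ⟨hsum, hlim⟩ :=
    tendsto_tsum_of_eventually_dominated hb N (fun n => tendsto_logP3Term (hne n)) hle
  have hjump : HasSum (fun n : ℕ => if (n : ℝ) + 1 + t < 0 then
      ((n : ℂ) + 1) * ((n : ℂ) + 1 + 1) / 2 * (Real.pi * Complex.I) else 0)
      ((m : ℂ) * ((m : ℂ) + 1) * ((m : ℂ) + 1 + 1) / 6 * (Real.pi * Complex.I)) := by
    rw [← sum_range_triangular, Finset.sum_mul]
    simp only [hlt]
    rw [Finset.sum_congr rfl fun n hn => (if_pos (Finset.mem_range.1 hn)).symm]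
    exact hasSum_sum_of_ne_finset_zero fun n hn => if_neg (mt Finset.mem_range.2 hn)
  have hreal := (hsum.hasSum.add hjump).tsum_eq
  simp only [sub_add_cancel] at hreal
  rw [Complex.ofReal_tsum, hreal, add_sub_cancel_right]
  exact hlim

/-- Boundary values of the holomorphic branch `L₃` of `log Γ₃(1+·)` on `(−k,−k+1)`. -/
theorem L3_boundary_limit :
    ∀ k : ℕ, 1 ≤ k → ∀ t : ℝ, t ∈ Set.Ioo (-(k:ℝ)) (-(k:ℝ)+1) →
      Tendsto L3 (𝓝[{z : ℂ | 0 < z.im}] (t : ℂ))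
        (𝓝 ((R3 t : ℂ) - Real.pi * (((k:ℂ)-1)*(k:ℂ)*((k:ℂ)+1)/6) * Complex.I)) := by
  intro k hk t ht
  obtain ⟨m, rfl⟩ := Nat.exists_eq_add_of_le' hk
  have ht' : t ∈ Set.Ioo (-((m : ℝ) + 1)) (-(m : ℝ)) := by
    push_cast at ht
    exact ⟨ht.1, by linarith [ht.2]⟩
  have hpoly : Tendsto (fun z : ℂ => (Dc : ℂ) * z ^ 3 + (Ec : ℂ) * z ^ 2 + (Fc : ℂ) * z)
      (𝓝[{z : ℂ | 0 < z.im}] (t : ℂ))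
      (𝓝 ((Dc : ℂ) * t ^ 3 + (Ec : ℂ) * t ^ 2 + (Fc : ℂ) * t)) :=
    (Continuous.tendsto (by fun_prop) (t : ℂ)).mono_left nhdsWithin_le_nhds
  have hR : R3 t = Dc * t ^ 3 + Ec * t ^ 2 + Fc * t + ∑' n, logAbsP3Term t n := rfl
  convert hpoly.add (tendsto_logP3 ht') using 1
  · rfl
  · rw [hR]
    congr 1
    push_cast
    ring
end
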